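/- If x* is an optimal feasible mechanism, then U_{x*}(s) ≥ 2s − 1 for every s ∈ [L,R]. -/

import Mathlib

open MeasureTheory Set Filter

noncomputable section

/-- The unit cube `[0,1]^m` inside `Fin m → ℝ`. -/
def cube (m : ℕ) : Set (Fin m → ℝ) := Set.univ.pi fun _ => Set.Icc (0:ℝ) 1

/-- `w⁺(y) = ∏ y_k · f(y_k)`. -/
def wplus (f : ℝ → ℝ) {m : ℕ} (y : Fin m → ℝ) : ℝ := ∏ k, y k * f (y k)

/-- `w⁻(y) = ∏ (1 - y_k) · f(y_k)`. -/
def wminus (f : ℝ → ℝ) {m : ℕ} (y : Fin m → ℝ) : ℝ := ∏ k, (1 - y k) * f (y k)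

/-- Hypotheses on the signal density `f` with derivative `f'` on `[L,R]`. -/
structure Density (f f' : ℝ → ℝ) (L R : ℝ) : Prop where
  nonneg : ∀ s, 0 ≤ f s
  zero_outside : ∀ s ∉ Set.Icc L R, f s = 0
  pos : ∀ s ∈ Set.Icc L R, 0 < f s
  hderiv : ∀ s ∈ Set.Icc L R, HasDerivWithinAt f (f' s) (Set.Icc L R) s
  cont_deriv : ContinuousOn f' (Set.Icc L R)
  total : (∫ s in L..R, f s) = 1
  mean : (∫ s in L..R, s * f s) = 1 / 2

/-- A mechanism is measurable with values in `[0,1]`. -/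
def IsMechanism {m : ℕ} (x : ℝ → (Fin m → ℝ) → ℝ) : Prop :=
  Measurable (Function.uncurry x) ∧ ∀ s y, x s y ∈ Set.Icc (0:ℝ) 1

/-- `A(t) = ∫_{[0,1]^m} x(t,y) w⁺(y) dy`. -/
def Amap (f : ℝ → ℝ) {m : ℕ} (x : ℝ → (Fin m → ℝ) → ℝ) (t : ℝ) : ℝ :=
  ∫ y in cube m, x t y * wplus f y

/-- `B(t) = ∫_{[0,1]^m} x(t,y) w⁻(y) dy`. -/
def Bmap (f : ℝ → ℝ) {m : ℕ} (x : ℝ → (Fin m → ℝ) → ℝ) (t : ℝ) : ℝ :=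
  ∫ y in cube m, x t y * wminus f y

/-- Interim payoff `U_x(t;s) = 2^m (s A(t) - (1-s) B(t))` (with `m = n-1`). -/
def Upay (f : ℝ → ℝ) {m : ℕ} (x : ℝ → (Fin m → ℝ) → ℝ) (t s : ℝ) : ℝ :=
  2 ^ m * (s * Amap f x t - (1 - s) * Bmap f x t)

/-- Feasibility: mechanism + participation + incentive compatibility on `[L,R]`. -/
def Feasible (f : ℝ → ℝ) (L R : ℝ) {m : ℕ} (x : ℝ → (Fin m → ℝ) → ℝ) : Prop :=
  IsMechanism x ∧ (∀ s ∈ Set.Icc L R, 0 ≤ Upay f x s s) ∧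
    (∀ s ∈ Set.Icc L R, ∀ t ∈ Set.Icc L R, Upay f x t s ≤ Upay f x s s)

/-- The designer's value `V(x)`. -/
def Value (f : ℝ → ℝ) (L R : ℝ) {m : ℕ} (x : ℝ → (Fin m → ℝ) → ℝ) : ℝ :=
  2 ^ m * ∫ s in L..R, (s * Amap f x s + (1 - s) * Bmap f x s) * f s

/-- The first-best utility `Ubar`. -/
def Ubar (f : ℝ → ℝ) (m : ℕ) (s : ℝ) : ℝ :=
  2 ^ m * ∫ y in cube m, max (s * wplus f y - (1 - s) * wminus f y) 0


lemma aux_prod {m : ℕ} (g : ℝ → ℝ) (hg : IntegrableOn g (Icc 0 1))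
    (hI : ∫ y in Icc (0:ℝ) 1, g y = 1 / 2) :
    IntegrableOn (fun y : Fin m → ℝ => ∏ k, g (y k)) (cube m) ∧
    ∫ y in cube m, ∏ k, g (y k) = (1 / 2) ^ m := by
  have e : (volume : Measure (Fin m → ℝ)).restrict (cube m)
      = Measure.pi (fun _ => (volume : Measure ℝ).restrict (Icc 0 1)) := by
    rw [cube, volume_pi, Measure.restrict_pi_pi]
  constructor
  · rw [IntegrableOn, e]
    exact Integrable.fintype_prod (f := fun _ => g) (fun _ => hg)
  · rw [e, integral_fintype_prod_eq_prod (f := fun _ => g)]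
    simp [hI]

lemma cube_meas (m : ℕ) : MeasurableSet (cube m) :=
  MeasurableSet.univ_pi fun _ => measurableSet_Icc

lemma aux_bd {m : ℕ} (g : ℝ → ℝ) (hgm : Measurable g) (hg : IntegrableOn g (Icc 0 1))
    (hI : ∫ y in Icc (0:ℝ) 1, g y = 1 / 2) (hpos : ∀ y ∈ Icc (0:ℝ) 1, 0 ≤ g y)
    (x : ℝ → (Fin m → ℝ) → ℝ) (hx : IsMechanism x) :
    Measurable (fun t => ∫ y in cube m, x t y * ∏ k, g (y k)) ∧
    ∀ t, 0 ≤ (∫ y in cube m, x t y * ∏ k, g (y k)) ∧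
      (∫ y in cube m, x t y * ∏ k, g (y k)) ≤ (1 / 2) ^ m := by
  obtain ⟨h1, h2⟩ := aux_prod (m := m) g hg hI
  have hw : Measurable (fun y : Fin m → ℝ => ∏ k, g (y k)) :=
    Finset.measurable_fun_prod _ fun k _ => hgm.comp (measurable_pi_apply k)
  have hw0 : ∀ y ∈ cube m, 0 ≤ ∏ k, g (y k) := fun y hy =>
    Finset.prod_nonneg fun k _ => hpos _ (hy k (mem_univ k))
  constructor
  · refine (StronglyMeasurable.integral_prod_right (f := fun t y => x t y * ∏ k, g (y k))
      ?_).measurable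
    refine Measurable.stronglyMeasurable ?_
    exact hx.1.mul (hw.comp measurable_snd)
  · intro t
    have hxt : Measurable (x t) := hx.1.comp (measurable_prodMk_left (x := t))
    constructor
    · exact setIntegral_nonneg (cube_meas m) fun y hy => mul_nonneg (hx.2 t y).1 (hw0 y hy)
    · rw [← h2]
      refine setIntegral_mono_on ?_ h1 (cube_meas m) fun y hy =>
        mul_le_of_le_one_left (hw0 y hy) (hx.2 t y).2
      refine Integrable.bdd_mul h1 (c := 1) hxt.aestronglyMeasurable (Eventually.of_forall fun y => ?_)
      rw [Real.norm_eq_abs, abs_of_nonneg (hx.2 t y).1]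
      exact (hx.2 t y).2

lemma dens_facts {f f' : ℝ → ℝ} {L R : ℝ} (hL : 0 ≤ L) (hLR : L < R) (hR : R ≤ 1)
    (hf : Density f f' L R) : Measurable f ∧ Integrable f ∧
    IntegrableOn (fun y => y * f y) (Icc 0 1) ∧ IntegrableOn (fun y => (1 - y) * f y) (Icc 0 1) ∧
    (∫ y in Icc (0:ℝ) 1, y * f y = 1 / 2) ∧ (∫ y in Icc (0:ℝ) 1, (1 - y) * f y = 1 / 2) := by
  have hc : ContinuousOn f (Icc L R) := fun s hs => (hf.hderiv s hs).continuousWithinAt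
  have hind : f = (Icc L R).indicator f := by
    ext s
    by_cases hs : s ∈ Icc L R
    · simp [hs]
    · simp [hs, hf.zero_outside s hs]
  have hfi : Integrable f := by
    rw [hind, integrable_indicator_iff measurableSet_Icc]
    exact hc.integrableOn_Icc
  have hfm : Measurable f := by
    classical
    have : f = (Icc L R).piecewise f 0 := by
      rw [piecewise_eq_indicator]; exact hind
    rw [this]
    exact hc.measurable_piecewise continuous_zero.continuousOn measurableSet_Icc
  have h1 : IntegrableOn (fun y => y * f y) (Icc 0 1) := by
    refine Integrable.bdd_mul (c := 1) hfi.integrableOn measurable_id.aestronglyMeasurable ?_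
    filter_upwards [ae_restrict_mem measurableSet_Icc] with y hy
    simpa [abs_of_nonneg hy.1] using hy.2
  have key : ∀ h : ℝ → ℝ, (∫ y in Icc (0:ℝ) 1, h y * f y) = ∫ y in L..R, h y * f y := by
    intro h
    rw [intervalIntegral.integral_of_le hLR.le, ← integral_Icc_eq_integral_Ioc]
    refine setIntegral_eq_of_subset_of_forall_sdiff_eq_zero measurableSet_Icc
      (Icc_subset_Icc hL hR) fun y hy => ?_
    rw [hf.zero_outside y hy.2, mul_zero]
  have h2 : (∫ y in Icc (0:ℝ) 1, y * f y) = 1 / 2 := by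
    rw [← hf.mean]; exact key fun y => y
  have h3 : (∫ y in Icc (0:ℝ) 1, f y) = 1 := by
    have h := key fun _ => 1
    simp only [one_mul] at h
    exact h.trans hf.total
  have e : (fun y => (1 - y) * f y) = fun y => f y - y * f y := by ext y; ring
  refine ⟨hfm, hfi, h1, ?_, h2, ?_⟩
  · rw [e]; exact hfi.integrableOn.sub h1
  · rw [e, integral_sub hfi.integrableOn h1, h2, h3]; norm_num

theorem stmt7 (n : ℕ) (hn : 2 ≤ n) (L R : ℝ) (hL : 0 ≤ L) (hLR : L < R) (hR : R ≤ 1)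
    (f f' : ℝ → ℝ) (hf : Density f f' L R)
    (xstar : ℝ → (Fin (n - 1) → ℝ) → ℝ) (hfeas : Feasible f L R xstar)
    (hopt : ∀ x : ℝ → (Fin (n - 1) → ℝ) → ℝ, Feasible f L R x →
      Value f L R x ≤ Value f L R xstar) :
    ∀ s ∈ Set.Icc L R, 2 * s - 1 ≤ Upay f xstar s s := by
  classical
  clear hn
  generalize n - 1 = m at *
  obtain ⟨hfm, hfi, hp1, hm1, hp2, hm2⟩ := dens_facts hL hLR hR hf
  have hA : ∀ x : ℝ → (Fin m → ℝ) → ℝ, IsMechanism x → Measurable (Amap f x) ∧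
      ∀ t, 0 ≤ Amap f x t ∧ Amap f x t ≤ (1/2)^m := fun x hx =>
    aux_bd (fun y => y * f y) (measurable_id.mul hfm) hp1 hp2
      (fun y hy => mul_nonneg hy.1 (hf.nonneg y)) x hx
  have hB : ∀ x : ℝ → (Fin m → ℝ) → ℝ, IsMechanism x → Measurable (Bmap f x) ∧
      ∀ t, 0 ≤ Bmap f x t ∧ Bmap f x t ≤ (1/2)^m := fun x hx =>
    aux_bd (fun y => (1 - y) * f y) ((measurable_const.sub measurable_id).mul hfm) hm1 hm2
      (fun y hy => mul_nonneg (sub_nonneg.2 hy.2) (hf.nonneg y)) x hx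
  have hone : (2:ℝ)^m * (1/2)^m = 1 := by rw [← mul_pow]; norm_num
  have h2m : (0:ℝ) < 2^m := by positivity
  have hhm : ((1:ℝ)/2)^m ≤ 1 := pow_le_one₀ (by norm_num) (by norm_num)
  have hV : ∀ x : ℝ → (Fin m → ℝ) → ℝ, IsMechanism x →
      IntervalIntegrable (fun s => (s * Amap f x s + (1 - s) * Bmap f x s) * f s) volume L R := by
    intro x hx
    rw [intervalIntegrable_iff_integrableOn_Ioc_of_le hLR.le]
    have := (hA x hx).1
    have := (hB x hx).1
    refine Integrable.mono' hfi.integrableOn (by fun_prop) ?_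
    filter_upwards [ae_restrict_mem measurableSet_Ioc] with s hs
    have a := (hA x hx).2 s
    have b := (hB x hx).2 s
    have hs0 : 0 ≤ s := hL.trans hs.1.le
    have hs1 : 0 ≤ 1 - s := by linarith [hs.2]
    have h0 : 0 ≤ s * Amap f x s + (1 - s) * Bmap f x s :=
      add_nonneg (mul_nonneg hs0 a.1) (mul_nonneg hs1 b.1)
    rw [Real.norm_eq_abs, abs_of_nonneg (mul_nonneg h0 (hf.nonneg s))]
    refine mul_le_of_le_one_left (hf.nonneg s) ?_
    nlinarith [mul_le_mul_of_nonneg_left (a.2.trans hhm) hs0,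
      mul_le_mul_of_nonneg_left (b.2.trans hhm) hs1]
  obtain ⟨hmech, hIR, hIC⟩ := hfeas
  have mA := (hA _ hmech).1
  have mB := (hB _ hmech).1
  have bA := (hA _ hmech).2
  have bB := (hB _ hmech).2
  have sA : ∀ t, 0 ≤ 2^m * Amap f xstar t ∧ 2^m * Amap f xstar t ≤ 1 := fun t =>
    ⟨mul_nonneg h2m.le (bA t).1, hone ▸ mul_le_mul_of_nonneg_left (bA t).2 h2m.le⟩
  have sB : ∀ t, 0 ≤ 2^m * Bmap f xstar t ∧ 2^m * Bmap f xstar t ≤ 1 := fun t =>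
    ⟨mul_nonneg h2m.le (bB t).1, hone ▸ mul_le_mul_of_nonneg_left (bB t).2 h2m.le⟩
  have Ue : ∀ t s, Upay f xstar t s
      = s * (2^m * Amap f xstar t) - (1 - s) * (2^m * Bmap f xstar t) := fun t s => by
    unfold Upay; ring
  by_contra hcon
  push Not at hcon
  obtain ⟨s0, hs0, hlt0⟩ := hcon
  let D : Set ℝ := {s | Upay f xstar s s < 2 * s - 1}
  have hD : MeasurableSet D := by
    refine measurableSet_lt ?_ (by fun_prop)
    unfold Upay
    fun_prop
  let x' : ℝ → (Fin m → ℝ) → ℝ := fun s y => if s ∈ D then 1 else xstar s y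
  have hx'mech : IsMechanism x' := by
    constructor
    · exact Measurable.ite (measurable_fst hD) measurable_const hmech.1
    · intro s y
      by_cases h : s ∈ D
      · simp [x', h]
      · simpa [x', h] using hmech.2 s y
  have A1 : ∀ t ∈ D, Amap f x' t = (1/2)^m := by
    intro t ht
    simp only [Amap, x', if_pos ht, one_mul]
    exact (aux_prod (fun y => y * f y) hp1 hp2).2
  have B1 : ∀ t ∈ D, Bmap f x' t = (1/2)^m := by
    intro t ht
    simp only [Bmap, x', if_pos ht, one_mul]
    exact (aux_prod (fun y => (1 - y) * f y) hm1 hm2).2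
  have A2 : ∀ t ∉ D, Amap f x' t = Amap f xstar t := by
    intro t ht
    simp only [Amap, x', if_neg ht]
  have B2 : ∀ t ∉ D, Bmap f x' t = Bmap f xstar t := by
    intro t ht
    simp only [Bmap, x', if_neg ht]
  have U1 : ∀ t ∈ D, ∀ s, Upay f x' t s = 2 * s - 1 := by
    intro t ht s
    rw [Upay, A1 t ht, B1 t ht]
    linear_combination (2 * s - 1) * hone
  have U2 : ∀ t ∉ D, ∀ s, Upay f x' t s = Upay f xstar t s := by
    intro t ht s
    rw [Upay, A2 t ht, B2 t ht, Upay]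
  have Uge : ∀ s, Upay f xstar s s ≤ Upay f x' s s ∧ 2 * s - 1 ≤ Upay f x' s s := by
    intro s
    by_cases h : s ∈ D
    · rw [U1 s h]; exact ⟨le_of_lt h, le_rfl⟩
    · rw [U2 s h]; exact ⟨le_rfl, not_lt.1 h⟩
  have hfeas' : Feasible f L R x' := by
    refine ⟨hx'mech, fun s hs => (hIR s hs).trans (Uge s).1, fun s hs t ht => ?_⟩
    by_cases h : t ∈ D
    · rw [U1 t h]; exact (Uge s).2
    · rw [U2 t h]; exact (hIC s hs t ht).trans (Uge s).1
  have hle := hopt x' hfeas'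
  -- an open interval inside D
  obtain ⟨p, q, hp, hpq, hq, hsub⟩ : ∃ p q, L ≤ p ∧ p < q ∧ q ≤ R ∧ Ioo p q ⊆ D := by
    rcases hs0.2.lt_or_eq with h | h
    · refine ⟨s0, R, hs0.1, h, le_rfl, fun s hs => ?_⟩
      have hic := hIC s0 hs0 s ⟨hs0.1.trans hs.1.le, hs.2.le⟩
      have e1 := Ue s s0
      have e2 := Ue s s
      change Upay f xstar s s < 2 * s - 1
      nlinarith [(sA s).2, (sB s).2, hs.1]
    · subst h
      refine ⟨max L ((Upay f xstar s0 s0 + 1) / 2), s0, le_max_left _ _,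
        max_lt hLR (by linarith), le_rfl, fun s hs => ?_⟩
      have hsL : L < s := (le_max_left _ _).trans_lt hs.1
      have hsU := (le_max_right L ((Upay f xstar s0 s0 + 1) / 2)).trans_lt hs.1
      have hic := hIC s0 hs0 s ⟨hsL.le, hs.2.le⟩
      have e1 := Ue s s0
      have e2 := Ue s s
      change Upay f xstar s s < 2 * s - 1
      nlinarith [(sA s).1, (sB s).1, hs.2]
  have i1 := hV _ hx'mech
  have i2 := hV _ hmech
  have hpt : ∀ s ∈ Icc L R, 0 ≤ (s * Amap f x' s + (1 - s) * Bmap f x' s) * f s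
      - (s * Amap f xstar s + (1 - s) * Bmap f xstar s) * f s := by
    intro s hs
    rw [← sub_mul]
    refine mul_nonneg ?_ (hf.nonneg s)
    by_cases h : s ∈ D
    · rw [A1 s h, B1 s h]
      have := mul_nonneg (hL.trans hs.1) (sub_nonneg.2 (bA s).2)
      have := mul_nonneg (sub_nonneg.2 (hs.2.trans hR)) (sub_nonneg.2 (bB s).2)
      linarith
    · rw [A2 s h, B2 s h, sub_self]
  have hpt' : ∀ s ∈ Ioo p q, 0 < (s * Amap f x' s + (1 - s) * Bmap f x' s) * f s
      - (s * Amap f xstar s + (1 - s) * Bmap f xstar s) * f s := by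
    intro s hs
    have h : s ∈ D := hsub hs
    have s1 : 0 < s := (hL.trans hp).trans_lt hs.1
    have s2 : 0 < 1 - s := by linarith [hs.2]
    rw [← sub_mul]
    refine mul_pos ?_ (hf.pos s ⟨hp.trans hs.1.le, hs.2.le.trans hq⟩)
    rw [A1 s h, B1 s h]
    have u1 := mul_nonneg s1.le (sub_nonneg.2 (bA s).2)
    have u2 := mul_nonneg s2.le (sub_nonneg.2 (bB s).2)
    by_contra hneg
    have z1 : s * ((1/2)^m - Amap f xstar s) = 0 := by linarith
    have z2 : (1 - s) * ((1/2)^m - Bmap f xstar s) = 0 := by linarith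
    have a1 := (mul_eq_zero.1 z1).resolve_left s1.ne'
    have a2 := (mul_eq_zero.1 z2).resolve_left s2.ne'
    have h' : Upay f xstar s s < 2 * s - 1 := h
    rw [Upay, ← sub_eq_zero.1 a1, ← sub_eq_zero.1 a2] at h'
    have : (2:ℝ)^m * (s * (1/2)^m - (1 - s) * (1/2)^m) = 2 * s - 1 := by
      linear_combination (2 * s - 1) * hone
    linarith
  have hpos : 0 < ∫ s in L..R, ((s * Amap f x' s + (1 - s) * Bmap f x' s) * f s
      - (s * Amap f xstar s + (1 - s) * Bmap f xstar s) * f s) := by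
    rw [intervalIntegral.integral_pos_iff_support_of_nonneg_ae' ?_ (i1.sub i2)]
    · refine ⟨hLR, ?_⟩
      have : 0 < volume (Ioo p q) := by simp [hpq]
      refine this.trans_le (measure_mono fun s hs => ⟨(hpt' s hs).ne', ?_⟩)
      exact ⟨hp.trans_lt hs.1, hs.2.le.trans hq⟩
    · rw [uIoc_of_le hLR.le]
      filter_upwards [ae_restrict_mem measurableSet_Ioc] with s hs
      exact hpt s (Ioc_subset_Icc_self hs)
  rw [intervalIntegral.integral_sub i1 i2] at hpos
  unfold Value at hle
  have := le_of_mul_le_mul_left hle h2m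
  linarith
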